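/- Let Λ be a Nakayama algebra and B_1, …, B_r a maximal backwards Hom-orthogonal sequence of bricks over Λ. Suppose i < k and there is a non-split short exact sequence 0 → B_i → B → B_k → 0 in which the middle term B is a brick. Then B ≅ B_j for some index j with i < j < k. -/

import Mathlib

/-- A bundled finite-dimensional module over the finite-dimensional `K`-algebra `Λ`
(finite-dimensionality over the base field is equivalent to being finitely
generated over `Λ`). -/
structure FDModule (Λ : Type) [Ring Λ] : Type 1 where
  carrier : Type
  [isAddCommGroup : AddCommGroup carrier]
  [isModule : Module Λ carrier]
  [isFinite : Module.Finite Λ carrier]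

attribute [instance] FDModule.isAddCommGroup FDModule.isModule FDModule.isFinite

/-- `M` is a brick: `M` is non-zero and every non-zero endomorphism of `M` is an
isomorphism. -/
def IsBrick {Λ : Type} [Ring Λ] (M : FDModule Λ) : Prop :=
  Nontrivial M.carrier ∧ ∀ f : M.carrier →ₗ[Λ] M.carrier, f = 0 ∨ Function.Bijective f

/-- `Hom_Λ(M, N) = 0`. -/
def NoHom {Λ : Type} [Ring Λ] (M N : FDModule Λ) : Prop :=
  ∀ f : M.carrier →ₗ[Λ] N.carrier, f = 0

/-- `0 → L → M → N → 0` is a short exact sequence. -/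
def IsShortExact {Λ : Type} [Ring Λ] {L M N : Type} [AddCommGroup L] [Module Λ L]
    [AddCommGroup M] [Module Λ M] [AddCommGroup N] [Module Λ N]
    (f : L →ₗ[Λ] M) (g : M →ₗ[Λ] N) : Prop :=
  Function.Injective f ∧ LinearMap.range f = LinearMap.ker g ∧ Function.Surjective g

/-- The short exact sequence with surjection `g` splits, i.e. `g` admits a
linear section. -/
def SESSplits {Λ : Type} [Ring Λ] {M N : Type} [AddCommGroup M] [Module Λ M]
    [AddCommGroup N] [Module Λ N] (g : M →ₗ[Λ] N) : Prop :=
  ∃ s : N →ₗ[Λ] M, g.comp s = LinearMap.id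

/-- The sequence of modules `B 0, …, B (r-1)` is backwards Hom-orthogonal:
`Hom(B j, B i) = 0` whenever `i < j`. -/
def BackwardsHomOrthogonal {Λ : Type} [Ring Λ] {r : ℕ} (B : Fin r → FDModule Λ) : Prop :=
  ∀ i j : Fin r, i < j → NoHom (B j) (B i)

/-- `B` is a maximal backwards Hom-orthogonal sequence of bricks: each entry is a
brick, the sequence is backwards Hom-orthogonal, and for every brick `C` and every
position `0 ≤ k ≤ r`, inserting `C` after the first `k` entries destroys backwards
Hom-orthogonality. -/
def IsMaximalBHO {Λ : Type} [Ring Λ] {r : ℕ} (B : Fin r → FDModule Λ) : Prop :=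
  (∀ i, IsBrick (B i)) ∧ BackwardsHomOrthogonal B ∧
    ∀ C : FDModule Λ, IsBrick C → ∀ k : ℕ, k ≤ r →
      ¬ ((∀ i : Fin r, (i : ℕ) < k → NoHom C (B i)) ∧
         (∀ j : Fin r, k ≤ (j : ℕ) → NoHom (B j) C))

/-- A module is uniserial if its submodules are totally ordered by inclusion. -/
def IsUniserialModule (Λ : Type) [Ring Λ] (M : Type) [AddCommGroup M] [Module Λ M] : Prop :=
  ∀ N₁ N₂ : Submodule Λ M, N₁ ≤ N₂ ∨ N₂ ≤ N₁

/-- A module is indecomposable if it is non-zero and is not the direct sum of two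
non-zero submodules. -/
def IsIndecomposableModule (Λ : Type) [Ring Λ] (M : Type) [AddCommGroup M]
    [Module Λ M] : Prop :=
  Nontrivial M ∧ ∀ N₁ N₂ : Submodule Λ M, IsCompl N₁ N₂ → N₁ = ⊥ ∨ N₂ = ⊥

/-- `Λ` is a Nakayama algebra: every finite-dimensional indecomposable `Λ`-module
is uniserial. -/
def IsNakayama (Λ : Type) [Ring Λ] : Prop :=
  ∀ M : FDModule Λ, IsIndecomposableModule Λ M.carrier → IsUniserialModule Λ M.carrier

theorem IsBrick.isIndecomposableModule {Λ : Type} [Ring Λ] {M : FDModule Λ} (hM : IsBrick M) :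
    IsIndecomposableModule Λ M.carrier := by
  refine ⟨hM.1, fun N₁ N₂ hN => ?_⟩
  rcases hM.2 (N₁.projection N₂ hN) with h | h
  · left
    rw [← Submodule.range_projection hN, h, LinearMap.range_zero]
  · right
    rw [← Submodule.ker_projection hN, LinearMap.ker_eq_bot.2 h.1]

/-- If two bricks `M`, `N` have morphisms in both directions with one composite non-zero,
they are isomorphic. -/
theorem IsBrick.nonempty_linearEquiv_of_comp_ne_zero {Λ : Type} [Ring Λ] {M N : FDModule Λ}
    (hM : IsBrick M) (hN : IsBrick N) (u : M.carrier →ₗ[Λ] N.carrier)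
    (h : N.carrier →ₗ[Λ] M.carrier) (huh : u ∘ₗ h ≠ 0) :
    Nonempty (M.carrier ≃ₗ[Λ] N.carrier) := by
  have hbij : Function.Bijective (u ∘ₗ h) := (hN.2 _).resolve_left huh
  have hne : h ∘ₗ u ≠ 0 := by
    intro h0
    apply huh
    ext x
    apply hbij.1
    have := LinearMap.congr_fun h0 (h x)
    simp only [LinearMap.comp_apply, LinearMap.zero_apply] at this
    simp [this]
  have hbij' : Function.Bijective (h ∘ₗ u) := (hM.2 _).resolve_left hne
  rw [LinearMap.coe_comp] at hbij hbij'
  exact ⟨LinearEquiv.ofBijective u ⟨hbij'.1.of_comp, hbij.2.of_comp⟩⟩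

/-- The middle term of a short exact sequence whose outer terms are bricks is not isomorphic
to the left term. -/
theorem IsBrick.isEmpty_linearEquiv_left {Λ : Type} [Ring Λ] {L M N : FDModule Λ}
    (hL : IsBrick L) (hN : IsBrick N) {f : L.carrier →ₗ[Λ] M.carrier}
    {g : M.carrier →ₗ[Λ] N.carrier} (hse : IsShortExact f g) :
    IsEmpty (M.carrier ≃ₗ[Λ] L.carrier) := by
  refine ⟨fun e => ?_⟩
  obtain ⟨hf, hfg, hg⟩ := hse
  have := hL.1
  have := hN.1
  rcases hL.2 (e.toLinearMap ∘ₗ f) with h | h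
  · obtain ⟨x, hx⟩ := exists_ne (0 : L.carrier)
    have h0 := LinearMap.congr_fun h x
    simp only [LinearMap.comp_apply, LinearMap.zero_apply, LinearEquiv.coe_coe,
      LinearEquiv.map_eq_zero_iff] at h0
    exact hx (hf (by simpa using h0))
  · obtain ⟨y, hy⟩ := exists_ne (0 : N.carrier)
    obtain ⟨m, rfl⟩ := hg y
    obtain ⟨x, hx⟩ := h.2 (e m)
    apply hy
    rw [← LinearMap.mem_ker, ← hfg]
    exact ⟨x, e.injective hx⟩

/-- The middle term of a short exact sequence whose outer terms are bricks is not isomorphic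
to the right term. -/
theorem IsBrick.isEmpty_linearEquiv_right {Λ : Type} [Ring Λ] {L M N : FDModule Λ}
    (hL : IsBrick L) (hN : IsBrick N) {f : L.carrier →ₗ[Λ] M.carrier}
    {g : M.carrier →ₗ[Λ] N.carrier} (hse : IsShortExact f g) :
    IsEmpty (M.carrier ≃ₗ[Λ] N.carrier) := by
  refine ⟨fun e => ?_⟩
  obtain ⟨hf, hfg, hg⟩ := hse
  have := hL.1
  have := hN.1
  rcases hN.2 (g ∘ₗ e.symm.toLinearMap) with h | h
  · obtain ⟨y, hy⟩ := exists_ne (0 : N.carrier)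
    obtain ⟨m, rfl⟩ := hg y
    apply hy
    simpa using LinearMap.congr_fun h (e m)
  · obtain ⟨x, hx⟩ := exists_ne (0 : L.carrier)
    apply hx
    apply hf
    rw [map_zero]
    have hk : g (f x) = 0 := LinearMap.mem_ker.1 (hfg ▸ ⟨x, rfl⟩)
    apply e.injective
    apply h.1
    simpa using hk

/-- A map killing the kernel of a surjection `g` factors through `g`. -/
theorem exists_comp_eq_of_surjective {Λ M N P : Type} [Ring Λ] [AddCommGroup M] [Module Λ M]
    [AddCommGroup N] [Module Λ N] [AddCommGroup P] [Module Λ P] (g : M →ₗ[Λ] N)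
    (hg : Function.Surjective g) (u : M →ₗ[Λ] P) (hu : LinearMap.ker g ≤ LinearMap.ker u) :
    ∃ v : N →ₗ[Λ] P, v ∘ₗ g = u := by
  refine ⟨(LinearMap.ker g).liftQ u hu ∘ₗ (g.quotKerEquivOfSurjective hg).symm.toLinearMap, ?_⟩
  ext x
  have : (g.quotKerEquivOfSurjective hg).symm (g x) = (LinearMap.ker g).mkQ x := by
    rw [LinearEquiv.symm_apply_eq]
    rfl
  simp [this]

/-- A map with range inside the range of an injection `f` factors through `f`. -/
theorem exists_comp_eq_of_injective {Λ L M P : Type} [Ring Λ] [AddCommGroup L] [Module Λ L]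
    [AddCommGroup M] [Module Λ M] [AddCommGroup P] [Module Λ P] (f : L →ₗ[Λ] M)
    (hf : Function.Injective f) (h : P →ₗ[Λ] M) (hh : LinearMap.range h ≤ LinearMap.range f) :
    ∃ w : P →ₗ[Λ] L, f ∘ₗ w = h := by
  refine ⟨(LinearEquiv.ofInjective f hf).symm.toLinearMap ∘ₗ
    h.codRestrict (LinearMap.range f) (fun x => hh ⟨x, rfl⟩), ?_⟩
  ext x
  exact congrArg Subtype.val ((LinearEquiv.ofInjective f hf).apply_symm_apply _)

/-- The middle term of the short exact sequence occurs in the maximal sequence. -/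
theorem IsMaximalBHO.exists_linearEquiv_of_isShortExact {Λ : Type} [Ring Λ] (hNak : IsNakayama Λ)
    {r : ℕ} {B : Fin r → FDModule Λ} (hmax : IsMaximalBHO B) {i k : Fin r} (hik : i < k)
    {M : FDModule Λ} (hM : IsBrick M) {f : (B i).carrier →ₗ[Λ] M.carrier}
    {g : M.carrier →ₗ[Λ] (B k).carrier} (hse : IsShortExact f g) :
    ∃ j, Nonempty (M.carrier ≃ₗ[Λ] (B j).carrier) := by
  obtain ⟨hB, hbho, hins⟩ := hmax
  have hg0 : ¬ NoHom M (B k) := by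
    intro h
    have := (hB k).1
    obtain ⟨y, hy⟩ := exists_ne (0 : (B k).carrier)
    obtain ⟨m, rfl⟩ := hse.2.2 y
    exact hy (by rw [h g, LinearMap.zero_apply])
  obtain ⟨a, ha, hamin⟩ := WellFounded.has_min (wellFounded_lt (α := Fin r))
    {l | ¬ NoHom M (B l)} ⟨k, hg0⟩
  have hb : ∃ b, a ≤ b ∧ ¬ NoHom (B b) M := by
    by_contra! hb
    exact hins M hM a a.2.le ⟨fun l hl => by_contra fun h => hamin l h hl, fun l hl => hb l hl⟩
  obtain ⟨b, hab, hb⟩ := hb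
  simp only [Set.mem_ofPred_eq, NoHom, not_forall] at ha hb
  obtain ⟨u, hu⟩ := ha
  obtain ⟨h, hh⟩ := hb
  by_cases huh : u ∘ₗ h = 0
  swap
  · obtain rfl : a = b := hab.eq_of_not_lt fun hlt => huh (hbho a b hlt _)
    exact ⟨a, hM.nonempty_linearEquiv_of_comp_ne_zero (hB a) u h huh⟩
  exfalso
  obtain ⟨hf, hfg, hg⟩ := hse
  have hgh : g ∘ₗ h = 0 → ∃ w : (B b).carrier →ₗ[Λ] (B i).carrier, f ∘ₗ w = h := fun h0 =>
    exists_comp_eq_of_injective f hf h (hfg ▸ LinearMap.range_le_ker_iff.2 h0)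
  by_cases huf : u ∘ₗ f = 0
  · obtain ⟨v, rfl⟩ := exists_comp_eq_of_surjective g hg u (hfg ▸ LinearMap.range_le_ker_iff.2 huf)
    have hv : v ≠ 0 := by rintro rfl; simp at hu
    have hka : k ≤ a := not_lt.1 fun hlt => hv (hbho a k hlt v)
    obtain rfl : a = k := le_antisymm (not_lt.1 fun hlt => hamin k hg0 hlt) hka
    have hvb := (hB a).2 v |>.resolve_left hv
    obtain ⟨w, rfl⟩ := hgh <| by
      ext x
      exact hvb.1 (by simpa using LinearMap.congr_fun huh x)
    exact hh (by rw [hbho i b (hik.trans_le hab) w, LinearMap.comp_zero])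
  · have hia : i ≤ a := not_lt.1 fun hlt => huf (hbho a i hlt _)
    by_cases hgh0 : g ∘ₗ h = 0
    · obtain ⟨w, rfl⟩ := hgh hgh0
      have hw : w ≠ 0 := by rintro rfl; simp at hh
      have hbi : b ≤ i := not_lt.1 fun hlt => hw (hbho i b hlt w)
      obtain rfl : b = i := le_antisymm hbi (hia.trans hab)
      have hwb := (hB b).2 w |>.resolve_left hw
      apply huf
      ext x
      obtain ⟨y, rfl⟩ := hwb.2 x
      exact LinearMap.congr_fun huh y
    · rw [← LinearMap.range_le_ker_iff] at huh huf hgh0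
      rw [← hfg] at hgh0
      rcases hNak M hM.isIndecomposableModule (LinearMap.range f) (LinearMap.range h) with hle | hle
      · exact huf (hle.trans huh)
      · exact hgh0 hle

/-- over a Nakayama algebra, if `B i` and `B k` (with `i < k`) are
entries of a maximal backwards Hom-orthogonal sequence of bricks and there is a
non-split short exact sequence `0 → B i → Bm → B k → 0` with `Bm` a brick, then
`Bm` is isomorphic to `B j` for some `i < j < k`. -/
theorem statement_12 (K : Type) [Field K] (Λ : Type) [Ring Λ] [Algebra K Λ]
    [FiniteDimensional K Λ] (hNak : IsNakayama Λ)
    {r : ℕ} (B : Fin r → FDModule Λ) (hmax : IsMaximalBHO B)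
    (i k : Fin r) (hik : i < k)
    (Bm : FDModule Λ) (hBm : IsBrick Bm)
    (f : (B i).carrier →ₗ[Λ] Bm.carrier) (g : Bm.carrier →ₗ[Λ] (B k).carrier)
    (hse : IsShortExact f g) (hns : ¬ SESSplits g) :
    ∃ j : Fin r, i < j ∧ j < k ∧ Nonempty (Bm.carrier ≃ₗ[Λ] (B j).carrier) := by
  obtain ⟨j, ⟨e⟩⟩ := hmax.exists_linearEquiv_of_isShortExact hNak hik hBm hse
  obtain ⟨hB, hbho, -⟩ := hmax
  refine ⟨j, lt_of_le_of_ne (not_lt.1 fun hlt => ?_) ?_,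
    lt_of_le_of_ne (not_lt.1 fun hlt => ?_) ?_, ⟨e⟩⟩
  · have := (hB i).1
    obtain ⟨x, hx⟩ := exists_ne (0 : (B i).carrier)
    have h0 := LinearMap.congr_fun (hbho j i hlt (e.toLinearMap ∘ₗ f)) x
    exact hx (hse.1 (e.injective (by simpa using h0)))
  · rintro rfl
    exact ((hB i).isEmpty_linearEquiv_left (hB k) hse).false e
  · have := (hB k).1
    obtain ⟨y, hy⟩ := exists_ne (0 : (B k).carrier)
    obtain ⟨m, rfl⟩ := hse.2.2 y
    have h0 := LinearMap.congr_fun (hbho k j hlt (g ∘ₗ e.symm.toLinearMap)) (e m)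
    exact hy (by simpa using h0)
  · rintro rfl
    exact ((hB i).isEmpty_linearEquiv_right (hB j) hse).false e
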